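/- For all total 0-1 matrices M and N: max{ rank₀₁(M)·fool(N), fool(M)·rank₀₁(N) } ≤ rank₀₁(M ⊗ N) ≤ rank₀₁(M)·rank₀₁(N), where M ⊗ N is the Kronecker (tensor) product. -/

import Mathlib

/-- `M` is a total 0-1 matrix: every entry is `0` or `1`. -/
def Is01 {α β : Type*} (M : Matrix α β ℝ) : Prop :=
  ∀ i j, M i j = 0 ∨ M i j = 1

/-- `M` is a sum of `r` entrywise-nonnegative rank-at-most-1 real matrices,
the `k`-th summand being the outer product of the nonnegative vectors `u k` and `v k`. -/
def NNDecomp {α β : Type*} (M : Matrix α β ℝ) (r : ℕ) : Prop :=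
  ∃ (u : Fin r → α → ℝ) (v : Fin r → β → ℝ),
    (∀ k i, 0 ≤ u k i) ∧ (∀ k j, 0 ≤ v k j) ∧
    ∀ i j, M i j = ∑ k, u k i * v k j

/-- The nonnegative rank `rank₊(M)`: the smallest `r` such that `M` is a sum of `r`
entrywise-nonnegative rank-at-most-1 real matrices. -/
noncomputable def nnRank {α β : Type*} (M : Matrix α β ℝ) : ℕ :=
  sInf {r | NNDecomp M r}

/-- `M` is a sum of `r` rank-at-most-1 matrices all of whose entries are in `{0,1}`,
the `k`-th summand being the outer product of the 0-1 vectors `u k` and `v k`. -/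
def BinDecomp {α β : Type*} (M : Matrix α β ℝ) (r : ℕ) : Prop :=
  ∃ (u : Fin r → α → ℝ) (v : Fin r → β → ℝ),
    (∀ k i, u k i = 0 ∨ u k i = 1) ∧ (∀ k j, v k j = 0 ∨ v k j = 1) ∧
    ∀ i j, M i j = ∑ k, u k i * v k j

/-- The binary rank `rank₀₁(M)`: the smallest `r` such that `M` is a sum of `r`
rank-at-most-1 matrices with entries in `{0,1}`. -/
noncomputable def binRank {α β : Type*} (M : Matrix α β ℝ) : ℕ :=
  sInf {r | BinDecomp M r}

/-- A fooling set of `M`: a set of positions of 1-entries such that for any two distinct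
positions `(a,b)` and `(c,d)` in it, `M a d = 0` or `M c b = 0`. -/
def IsFoolingSet {α β : Type*} (M : Matrix α β ℝ) (S : Finset (α × β)) : Prop :=
  (∀ p ∈ S, M p.1 p.2 = 1) ∧
  ∀ p ∈ S, ∀ q ∈ S, p ≠ q → M p.1 q.2 = 0 ∨ M q.1 p.2 = 0

/-- `fool M` is the maximum size of a fooling set of `M`. -/
noncomputable def fool {α β : Type*} (M : Matrix α β ℝ) : ℕ :=
  sSup {s | ∃ S : Finset (α × β), IsFoolingSet M S ∧ S.card = s}

theorem BinDecomp.of_fintype {α β ι : Type*} [Fintype ι] {M : Matrix α β ℝ}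
    (u : ι → α → ℝ) (v : ι → β → ℝ)
    (hu : ∀ k i, u k i = 0 ∨ u k i = 1) (hv : ∀ k j, v k j = 0 ∨ v k j = 1)
    (h : ∀ i j, M i j = ∑ k, u k i * v k j) : BinDecomp M (Fintype.card ι) := by
  let e := (Fintype.equivFin ι).symm
  refine ⟨fun k => u (e k), fun k => v (e k), fun k => hu _, fun k => hv _, fun i j => ?_⟩
  rw [h, ← Equiv.sum_comp e]

theorem Is01.exists_binDecomp {α β : Type*} [Fintype α] [DecidableEq α] {M : Matrix α β ℝ}
    (hM : Is01 M) : BinDecomp M (Fintype.card α) :=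
  .of_fintype (fun a i => if i = a then 1 else 0) M
    (fun k i => by by_cases h : i = k <;> simp [h]) hM (by simp)

theorem binRank_le {α β : Type*} {M : Matrix α β ℝ} {r : ℕ} (h : BinDecomp M r) :
    binRank M ≤ r :=
  Nat.sInf_le h

theorem Is01.binDecomp_binRank {α β : Type*} [Fintype α] [DecidableEq α] {M : Matrix α β ℝ}
    (hM : Is01 M) : BinDecomp M (binRank M) :=
  Nat.sInf_mem (s := {r | BinDecomp M r}) ⟨_, hM.exists_binDecomp⟩

theorem exists_isFoolingSet_card_eq_fool {α β : Type*} [Fintype α] [Fintype β]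
    (M : Matrix α β ℝ) : ∃ S : Finset (α × β), IsFoolingSet M S ∧ S.card = fool M := by
  refine Nat.sSup_mem (s := {s | ∃ S : Finset (α × β), IsFoolingSet M S ∧ S.card = s})
    ⟨0, ∅, by simp [IsFoolingSet], rfl⟩ ⟨Fintype.card (α × β), ?_⟩
  rintro _ ⟨S, -, rfl⟩
  exact S.card_le_univ

theorem BinDecomp.kronecker {α β γ δ : Type*} {M : Matrix α β ℝ} {N : Matrix γ δ ℝ} {r s : ℕ}
    (hM : BinDecomp M r) (hN : BinDecomp N s) :
    BinDecomp (Matrix.kroneckerMap (· * ·) M N) (r * s) := by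
  obtain ⟨u, v, hu, hv, h⟩ := hM
  obtain ⟨u', v', hu', hv', h'⟩ := hN
  have key := BinDecomp.of_fintype (M := Matrix.kroneckerMap (· * ·) M N)
    (fun (k : Fin r × Fin s) i => u k.1 i.1 * u' k.2 i.2) (fun k j => v k.1 j.1 * v' k.2 j.2)
    (fun k i => by rcases hu k.1 i.1 with h | h <;> rcases hu' k.2 i.2 with h' | h' <;> simp [h, h'])
    (fun k i => by rcases hv k.1 i.1 with h | h <;> rcases hv' k.2 i.2 with h' | h' <;> simp [h, h'])
    (fun i j => by
      rw [Matrix.kroneckerMap_apply, h, h', Finset.sum_mul_sum, Fintype.sum_prod_type]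
      exact Finset.sum_congr rfl fun _ _ => Finset.sum_congr rfl fun _ _ => by ring)
  simpa using key

/-- If `K` contains the tensor product of `M` and `N` as a submatrix, a decomposition of `K` into
`r` rectangles splits, along a fooling set of `N`, into disjoint decompositions of `M`. -/
theorem binRank_mul_card_le {α β γ δ ρ σ : Type*} {M : Matrix α β ℝ} {N : Matrix γ δ ℝ}
    {K : Matrix ρ σ ℝ} (e : α → γ → ρ) (f : β → δ → σ)
    (hK : ∀ i a j b, K (e i a) (f j b) = M i j * N a b)
    {S : Finset (γ × δ)} (hS : IsFoolingSet N S) {r : ℕ} (hr : BinDecomp K r) :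
    binRank M * S.card ≤ r := by
  classical
  obtain ⟨u, v, hu, hv, h⟩ := hr
  have entry_ne_zero : ∀ k x y, u k x ≠ 0 → v k y ≠ 0 → K x y ≠ 0 := by
    intro k x y hx hy
    have nonneg : ∀ l ∈ Finset.univ, 0 ≤ u l x * v l y := fun l _ => by
      rcases hu l x with h | h <;> rcases hv l y with h' | h' <;> simp [h, h']
    rw [h, Ne, Finset.sum_eq_zero_iff_of_nonneg nonneg]
    exact fun H => mul_ne_zero hx hy (H k (Finset.mem_univ k))
  let T : γ × δ → Finset (Fin r) := fun p =>
    {k | ∃ i j, u k (e i p.1) ≠ 0 ∧ v k (f j p.2) ≠ 0}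
  have disj : (S : Set (γ × δ)).PairwiseDisjoint T := by
    intro p hp q hq hpq
    refine Finset.disjoint_left.2 fun k hk hk' => ?_
    obtain ⟨i, j, h₁, h₂⟩ := (Finset.mem_filter.1 hk).2
    obtain ⟨i', j', h₃, h₄⟩ := (Finset.mem_filter.1 hk').2
    have hpq₁ := entry_ne_zero k _ _ h₁ h₄
    have hpq₂ := entry_ne_zero k _ _ h₃ h₂
    rw [hK] at hpq₁ hpq₂
    rcases hS.2 p hp q hq hpq with h | h
    · exact hpq₁ (by rw [h, mul_zero])
    · exact hpq₂ (by rw [h, mul_zero])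
  have rank_le : ∀ p ∈ S, binRank M ≤ (T p).card := by
    intro p hp
    rw [← Fintype.card_coe]
    refine binRank_le (.of_fintype (fun (k : T p) i => u k (e i p.1)) (fun k j => v k (f j p.2))
      (fun _ _ => hu _ _) (fun _ _ => hv _ _) fun i j => ?_)
    rw [← mul_one (M i j), ← hS.1 p hp, ← hK, h,
      Finset.sum_coe_sort (T p) (fun k => u k (e i p.1) * v k (f j p.2))]
    refine (Finset.sum_subset (Finset.subset_univ _) fun k _ hk => ?_).symm
    by_contra hne
    exact hk (Finset.mem_filter.2 ⟨Finset.mem_univ k, i, j, left_ne_zero_of_mul hne,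
      right_ne_zero_of_mul hne⟩)
  calc binRank M * S.card = ∑ _p ∈ S, binRank M := by simp [mul_comm]
    _ ≤ ∑ p ∈ S, (T p).card := Finset.sum_le_sum rank_le
    _ = (S.biUnion T).card := (Finset.card_biUnion disj).symm
    _ ≤ r := by simpa using (S.biUnion T).card_le_univ

/-- For all total 0-1 matrices `M` and `N`,
`max (rank₀₁(M)·fool(N), fool(M)·rank₀₁(N)) ≤ rank₀₁(M ⊗ N) ≤ rank₀₁(M)·rank₀₁(N)`. -/
theorem binRank_kronecker (n₁ m₁ n₂ m₂ : ℕ)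
    (M : Matrix (Fin n₁) (Fin m₁) ℝ) (N : Matrix (Fin n₂) (Fin m₂) ℝ)
    (hM : Is01 M) (hN : Is01 N) :
    max (binRank M * fool N) (fool M * binRank N) ≤
        binRank (Matrix.kroneckerMap (· * ·) M N) ∧
      binRank (Matrix.kroneckerMap (· * ·) M N) ≤ binRank M * binRank N := by
  have hr := hM.binDecomp_binRank.kronecker hN.binDecomp_binRank
  have hmin : BinDecomp (Matrix.kroneckerMap (· * ·) M N)
      (binRank (Matrix.kroneckerMap (· * ·) M N)) :=
    Nat.sInf_mem (s := {r | BinDecomp (Matrix.kroneckerMap (· * ·) M N) r}) ⟨_, hr⟩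
  refine ⟨max_le ?_ ?_, binRank_le hr⟩
  · obtain ⟨S, hS, hcard⟩ := exists_isFoolingSet_card_eq_fool N
    rw [← hcard]
    exact binRank_mul_card_le Prod.mk Prod.mk (fun _ _ _ _ => rfl) hS hmin
  · obtain ⟨S, hS, hcard⟩ := exists_isFoolingSet_card_eq_fool M
    rw [← hcard, mul_comm]
    exact binRank_mul_card_le (fun i a => (a, i)) (fun j b => (b, j))
      (fun _ _ _ _ => mul_comm _ _) hS hmin
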